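/- Existence, uniqueness and monotonicity of ε_n (Lemma B.1): Let p ∈ [1,2], α, τ > 0, and let Π(·|α,τ) be the α-regular τ-scaled p-exponential prior on ℓ₂. Let θ₀ ∈ ℓ₂ and fix K > 0. Then for every n ≥ 1 there exists a unique ε_n = ε_n(α,τ;K,θ₀) > 0 such that Π(θ : ‖θ−θ₀‖₂ ≤ Kε_n | α,τ) = e^{−nε_n²}. Furthermore, for fixed α, τ > 0, the sequence (ε_n)_{n≥1} is strictly decreasing and converges to zero. -/

import Mathlib

noncomputable section

open MeasureTheory ProbabilityTheory Filter Set

/-- The index `ℓ = i + 1 ≥ 1` associated to the coordinate `i : ℕ`. -/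
def idx (i : ℕ) : ℝ := (i : ℝ) + 1

/-- The `p`-exponential probability density on `ℝ`:
`f_p(x) = exp(−|x|^p/p) / (2 Γ(1/p) p^{1/p−1})`. -/
def pexpDensity (p x : ℝ) : ℝ :=
  Real.exp (-|x| ^ p / p) / (2 * Real.Gamma (1 / p) * p ^ (1 / p - 1))

/-- The `p`-exponential probability measure on `ℝ`. -/
def pexpMeasure (p : ℝ) : Measure ℝ :=
  MeasureTheory.volume.withDensity fun x => ENNReal.ofReal (pexpDensity p x)

/-- The law of the `i`-th coordinate `τ ℓ^{−1/2−α} ξ` (with `ℓ = i+1`) of a draw from the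
`α`-regular `τ`-scaled `p`-exponential prior. -/
def coordLaw (p α τ : ℝ) (i : ℕ) : Measure ℝ :=
  (pexpMeasure p).map fun x => τ * idx i ^ (-(1 / 2 : ℝ) - α) * x

/-- `μ` is the `α`-regular `τ`-scaled `p`-exponential prior on `ℝ^ℕ`: the joint law of the
independent coordinates `τ ℓ^{−1/2−α} ξ_ℓ` with `ξ_ℓ` i.i.d. `p`-exponential. -/
def IsPexpPrior (p α τ : ℝ) (μ : Measure (ℕ → ℝ)) : Prop :=
  IsProbabilityMeasure μ ∧
  IsProjectiveLimit μ fun I : Finset ℕ => Measure.pi fun i : I => coordLaw p α τ i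

/-- `μ` is the Gaussian sequence model measure `P^n_θ`: the joint law of independent
coordinates `X_ℓ ~ N(θ_ℓ, 1/n)`. -/
def IsGaussModel (n : ℕ) (θ : ℕ → ℝ) (μ : Measure (ℕ → ℝ)) : Prop :=
  IsProbabilityMeasure μ ∧
  IsProjectiveLimit μ fun I : Finset ℕ =>
    Measure.pi fun i : I => gaussianReal (θ i) ((n : NNReal))⁻¹

/-- The `ℓ₂` norm of a sequence (with the `tsum` junk-value convention). -/
def l2norm (θ : ℕ → ℝ) : ℝ := Real.sqrt (∑' i, θ i ^ 2)

/-- Membership in the Sobolev ball `H^β(L)`. -/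
def inSobolevBall (β L : ℝ) (θ : ℕ → ℝ) : Prop :=
  Summable (fun i => idx i ^ (2 * β) * θ i ^ 2) ∧
    Real.sqrt (∑' i, idx i ^ (2 * β) * θ i ^ 2) ≤ L

/-- The log-likelihood `ℓ_n(θ) = n Σ_ℓ X_ℓ θ_ℓ − (n/2) ‖θ‖₂²` in the Gaussian sequence model. -/
def loglik (n : ℕ) (θ X : ℕ → ℝ) : ℝ :=
  (n : ℝ) * (∑' i, X i * θ i) - (n : ℝ) / 2 * ∑' i, θ i ^ 2

/-- The likelihood ratio `p^n_θ(X) = dP^n_θ/dP^n_0 (X)`. -/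
def lik (n : ℕ) (θ X : ℕ → ℝ) : ℝ := Real.exp (loglik n θ X)

/-- The marginal likelihood of the data `X` for the prior `prior`. -/
def marginalLik (n : ℕ) (prior : Measure (ℕ → ℝ)) (X : ℕ → ℝ) : ℝ :=
  ∫ θ, lik n θ X ∂prior

/-- The posterior mass of a set `B` given data `X`, for the prior `prior`. -/
def post (n : ℕ) (prior : Measure (ℕ → ℝ)) (X : ℕ → ℝ) (B : Set (ℕ → ℝ)) : ℝ :=
  (∫ θ in B, lik n θ X ∂prior) / marginalLik n prior X

lemma integrable_of_even_of_integrableOn_Ioi {f : ℝ → ℝ} (heven : ∀ x, f (-x) = f x)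
    (hf : IntegrableOn f (Ioi 0)) : Integrable f := by
  rw [← integrableOn_univ, ← Iio_union_Ici (a := (0 : ℝ)), integrableOn_union,
    integrableOn_Ici_iff_integrableOn_Ioi]
  refine ⟨?_, hf⟩
  have h := (Measure.measurePreserving_neg (volume : Measure ℝ)).integrableOn_comp_preimage
    (Homeomorph.neg ℝ).measurableEmbedding (f := f) (s := Ioi 0)
  have h2 := h.2 hf
  simpa [Function.comp_def, heven] using h2

lemma pexpDensity_pos {p : ℝ} (hp : 0 < p) (x : ℝ) : 0 < pexpDensity p x := by
  unfold pexpDensity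
  have := Real.Gamma_pos_of_pos (one_div_pos.2 hp)
  positivity

lemma measurable_pexpDensity (p : ℝ) : Measurable (pexpDensity p) := by
  unfold pexpDensity
  fun_prop

lemma integrable_rpow_abs_mul_pexpDensity {p s : ℝ} (hp : 0 < p) (hs : -1 < s) :
    Integrable fun x => |x| ^ s * pexpDensity p x := by
  refine integrable_of_even_of_integrableOn_Ioi (fun x => by simp [pexpDensity]) ?_
  have h := (integrableOn_rpow_mul_exp_neg_mul_rpow hs hp (one_div_pos.2 hp)).mul_const
    (2 * Real.Gamma (1 / p) * p ^ (1 / p - 1))⁻¹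
  refine IntegrableOn.congr_fun h (fun x hx => ?_) measurableSet_Ioi
  simp only [pexpDensity, abs_of_pos (mem_Ioi.1 hx), div_eq_mul_inv, one_mul]
  rw [mul_assoc]
  congr 3
  ring

lemma isFiniteMeasure_pexpMeasure {p : ℝ} (hp : 0 < p) : IsFiniteMeasure (pexpMeasure p) := by
  refine isFiniteMeasure_withDensity_ofReal (Integrable.hasFiniteIntegral ?_)
  simpa using integrable_rpow_abs_mul_pexpDensity hp (s := 0) (by norm_num)

lemma lintegral_sq_pexpMeasure_ne_top {p : ℝ} (hp : 0 < p) :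
    ∫⁻ x, ENNReal.ofReal (x ^ 2) ∂pexpMeasure p ≠ ⊤ := by
  rw [pexpMeasure, lintegral_withDensity_eq_lintegral_mul _
    (measurable_pexpDensity p).ennreal_ofReal (by fun_prop)]
  have h := (integrable_rpow_abs_mul_pexpDensity hp (s := 2) (by norm_num)).lintegral_lt_top
  refine ne_of_eq_of_ne (lintegral_congr fun x => ?_) h.ne
  rw [Pi.mul_apply, ← ENNReal.ofReal_mul (pexpDensity_pos hp x).le, mul_comm]
  norm_cast
  rw [sq_abs]

lemma nullSingletonClass_pexpMeasure (p : ℝ) : NullSingletonClass (pexpMeasure p) :=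
  ⟨fun x => withDensity_absolutelyContinuous _ _ (measure_singleton x)⟩

lemma isOpenPosMeasure_pexpMeasure {p : ℝ} (hp : 0 < p) :
    (pexpMeasure p).IsOpenPosMeasure := by
  refine (withDensity_absolutelyContinuous' (μ := volume)
    (measurable_pexpDensity p).ennreal_ofReal.aemeasurable ?_).isOpenPosMeasure
  exact ae_of_all _ fun x => by simp [pexpDensity_pos hp x]

/-- The scaling factor `τ ℓ^{−1/2−α}` (with `ℓ = i+1`) of the `i`-th coordinate of the prior. -/
def coordScale (α τ : ℝ) (i : ℕ) : ℝ := τ * idx i ^ (-(1 / 2 : ℝ) - α)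

lemma idx_pos (i : ℕ) : 0 < idx i := by unfold idx; positivity

lemma coordScale_pos {τ : ℝ} (α : ℝ) (hτ : 0 < τ) (i : ℕ) : 0 < coordScale α τ i :=
  mul_pos hτ (Real.rpow_pos_of_pos (idx_pos i) _)

lemma summable_coordScale_sq {α : ℝ} (hα : 0 < α) (τ : ℝ) :
    Summable fun i => coordScale α τ i ^ 2 := by
  have h : Summable fun n : ℕ => (n : ℝ) ^ (-1 - 2 * α) :=
    Real.summable_nat_rpow.2 (by linarith)
  refine (((summable_nat_add_iff 1).2 h).mul_left (τ ^ 2)).congr fun i => ?_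
  rw [coordScale, mul_pow, ← Real.rpow_natCast (idx i ^ _), ← Real.rpow_mul (idx_pos i).le, idx]
  push_cast
  congr 2
  ring

lemma coordLaw_eq (p α τ : ℝ) (i : ℕ) :
    coordLaw p α τ i = (pexpMeasure p).map fun x => coordScale α τ i * x := rfl

lemma nullSingletonClass_coordLaw (p α : ℝ) {τ : ℝ} (hτ : 0 < τ) (i : ℕ) :
    NullSingletonClass (coordLaw p α τ i) := by
  have := nullSingletonClass_pexpMeasure p
  refine ⟨fun y => ?_⟩
  rw [coordLaw_eq, Measure.map_apply (by fun_prop) (measurableSet_singleton y)]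
  refine Set.Subsingleton.measure_zero (fun a ha b hb => ?_) _
  exact mul_left_cancel₀ (coordScale_pos α hτ i).ne' (ha.trans (Eq.symm hb))

lemma isOpenPosMeasure_coordLaw {p τ : ℝ} (hp : 0 < p) (α : ℝ) (hτ : 0 < τ) (i : ℕ) :
    (coordLaw p α τ i).IsOpenPosMeasure := by
  have := isOpenPosMeasure_pexpMeasure hp
  rw [coordLaw_eq]
  exact Continuous.isOpenPosMeasure_map (by fun_prop)
    (mul_left_surjective₀ (coordScale_pos α hτ i).ne')

lemma tsum_lintegral_sq_sub_coordLaw_ne_top {p α : ℝ} (hp : 0 < p) (hα : 0 < α) (τ : ℝ)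
    {θ₀ : ℕ → ℝ} (hθ₀ : Summable fun i => θ₀ i ^ 2) :
    ∑' i, ∫⁻ x, ENNReal.ofReal ((x - θ₀ i) ^ 2) ∂coordLaw p α τ i ≠ ⊤ := by
  have := isFiniteMeasure_pexpMeasure hp
  have hle (i : ℕ) : ∫⁻ x, ENNReal.ofReal ((x - θ₀ i) ^ 2) ∂coordLaw p α τ i ≤
      ENNReal.ofReal (2 * coordScale α τ i ^ 2) *
          ∫⁻ x, ENNReal.ofReal (x ^ 2) ∂pexpMeasure p +
        ENNReal.ofReal (2 * θ₀ i ^ 2) * pexpMeasure p univ := by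
    rw [coordLaw_eq, lintegral_map (by fun_prop) (by fun_prop),
      ← lintegral_const_mul _ (by fun_prop), ← lintegral_const,
      ← lintegral_add_right _ measurable_const]
    refine lintegral_mono fun x => ?_
    simp only
    rw [← ENNReal.ofReal_mul (by positivity), ← ENNReal.ofReal_add (by positivity) (by positivity)]
    refine ENNReal.ofReal_le_ofReal ?_
    nlinarith [sq_nonneg (coordScale α τ i * x + θ₀ i)]
  refine ne_top_of_le_ne_top ?_ (ENNReal.tsum_le_tsum hle)
  rw [ENNReal.tsum_add, ENNReal.tsum_mul_right, ENNReal.tsum_mul_right]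
  exact ENNReal.add_ne_top.2
    ⟨ENNReal.mul_ne_top ((summable_coordScale_sq hα τ).mul_left 2).tsum_ofReal_ne_top
      (lintegral_sq_pexpMeasure_ne_top hp),
    ENNReal.mul_ne_top (hθ₀.mul_left 2).tsum_ofReal_ne_top (measure_ne_top _ _)⟩

lemma IsPexpPrior.isProbabilityMeasure_coordLaw {p α τ : ℝ} {μ : Measure (ℕ → ℝ)} (hp : 0 < p)
    (h : IsPexpPrior p α τ μ) (i : ℕ) : IsProbabilityMeasure (coordLaw p α τ i) := by
  have := isFiniteMeasure_pexpMeasure hp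
  have (i : ℕ) : IsFiniteMeasure (coordLaw p α τ i) := by unfold coordLaw; infer_instance
  have := h.1
  have huniv := h.2.measure_univ_eq {i}
  rw [measure_univ, Measure.pi_univ] at huniv
  exact ⟨by simpa using huniv.symm⟩

lemma IsPexpPrior.eq_infinitePi {p α τ : ℝ} {μ : Measure (ℕ → ℝ)}
    [∀ i, IsProbabilityMeasure (coordLaw p α τ i)] (h : IsPexpPrior p α τ μ) :
    μ = Measure.infinitePi (coordLaw p α τ) :=
  h.2.unique (Measure.isProjectiveLimit_infinitePi _)

/-- If `F` is a continuous increasing function rising from `0` at `0` to `1` at infinity and positive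
on `(0, ∞)`, the equations `F x = exp (-n x ^ 2)` have unique positive solutions, which strictly
decrease to zero. -/
lemma exists_unique_eq_exp_neg_mul_sq {F : ℝ → ℝ} (hmono : Monotone F) (hcont : Continuous F)
    (hzero : F 0 = 0) (htop : Tendsto F atTop (nhds 1)) (hpos : ∀ x, 0 < x → 0 < F x) :
    ∃ e : ℕ → ℝ,
      (∀ n : ℕ, 1 ≤ n → 0 < e n ∧ F (e n) = Real.exp (-(n : ℝ) * (e n) ^ 2) ∧
        ∀ x : ℝ, 0 < x → F x = Real.exp (-(n : ℝ) * x ^ 2) → x = e n) ∧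
      (∀ m n : ℕ, 1 ≤ m → m < n → e n < e m) ∧
      Tendsto e atTop (nhds 0) := by
  have hstrict {n : ℕ} (hn : 1 ≤ n) {x y : ℝ} (hx : 0 ≤ x) (hxy : x < y) :
      Real.exp (-(n : ℝ) * y ^ 2) < Real.exp (-(n : ℝ) * x ^ 2) := by
    have hn' : (0 : ℝ) < n := by exact_mod_cast hn
    rw [Real.exp_lt_exp]
    nlinarith [mul_pos hn' (show 0 < y ^ 2 - x ^ 2 by nlinarith)]
  have hexists (n : ℕ) (hn : 1 ≤ n) : ∃ x, 0 < x ∧ F x = Real.exp (-(n : ℝ) * x ^ 2) := by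
    have hn' : (1 : ℝ) ≤ n := by exact_mod_cast hn
    obtain ⟨b, hFb, hb⟩ := ((htop.eventually_const_lt
      (show Real.exp (-1) < 1 by simp)).and (eventually_ge_atTop 1)).exists
    have hb' : Real.exp (-(n : ℝ) * b ^ 2) ≤ F b := by
      refine le_trans (Real.exp_le_exp.2 ?_) hFb.le
      nlinarith
    have hc : Continuous fun x => F x - Real.exp (-(n : ℝ) * x ^ 2) := by fun_prop
    obtain ⟨x, hx, hx0⟩ := intermediate_value_Icc (zero_le_one.trans hb) hc.continuousOn
      (show (0 : ℝ) ∈ Icc _ _ from ⟨by simp [hzero], sub_nonneg.2 hb'⟩)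
    have hx0 : F x - Real.exp (-(n : ℝ) * x ^ 2) = 0 := hx0
    refine ⟨x, lt_of_le_of_ne hx.1 ?_, sub_eq_zero.1 hx0⟩
    rintro rfl
    simp [hzero] at hx0
  choose! e he0 he using hexists
  have hanti (m n : ℕ) (hm : 1 ≤ m) (hmn : m < n) : e n < e m := by
    have hn := hm.trans hmn.le
    by_contra! hle
    have h1 : F (e m) ≤ F (e n) := hmono hle
    rw [he m hm, he n hn, Real.exp_le_exp] at h1
    have hmn' : (m : ℝ) < n := by exact_mod_cast hmn
    have := he0 m hm
    have h2 : e m ^ 2 ≤ e n ^ 2 := by gcongr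
    nlinarith [mul_pos (sub_pos.2 hmn') (pow_pos this 2), mul_le_mul_of_nonneg_left h2 n.cast_nonneg]
  refine ⟨e, fun n hn => ⟨he0 n hn, he n hn, fun x hx hFx => ?_⟩, hanti, ?_⟩
  · rcases lt_trichotomy x (e n) with h | h | h
    · exact absurd ((hmono h.le).trans_lt' (he n hn ▸ hFx ▸ hstrict hn hx.le h)) (lt_irrefl _)
    · exact h
    · exact absurd ((hmono h.le).trans_lt' (he n hn ▸ hFx ▸ hstrict hn (he0 n hn).le h))
        (lt_irrefl _)
  · rw [Metric.tendsto_atTop']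
    intro δ hδ
    have hlim : Tendsto (fun n : ℕ => Real.exp (-(n : ℝ) * δ ^ 2)) atTop (nhds 0) := by
      refine Real.tendsto_exp_atBot.comp ?_
      exact (tendsto_neg_atTop_atBot.comp tendsto_natCast_atTop_atTop).atBot_mul_const
        (by positivity)
    obtain ⟨N, hN⟩ := (eventually_atTop.1 (hlim.eventually_lt_const (hpos δ hδ)))
    refine ⟨N, fun n hn => ?_⟩
    have hn1 : 1 ≤ n := by omega
    rw [Real.dist_eq, sub_zero, abs_of_pos (he0 n hn1)]
    by_contra! hle
    have h1 := hmono hle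
    rw [he n hn1] at h1
    have h2 : Real.exp (-(n : ℝ) * e n ^ 2) ≤ Real.exp (-(n : ℝ) * δ ^ 2) := by
      rw [Real.exp_le_exp, neg_mul, neg_mul]
      gcongr
    linarith [hN n hn.le]

section ProductMeasure

variable {ν : ℕ → Measure ℝ} {θ₀ : ℕ → ℝ}

/-- The extended squared `ℓ₂` distance between the coordinates of index at least `N` of `θ` and
`θ₀`. -/
def tailSqDist (θ₀ : ℕ → ℝ) (N : ℕ) (θ : ℕ → ℝ) : ENNReal :=
  ∑' i, ENNReal.ofReal ((θ (i + N) - θ₀ (i + N)) ^ 2)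

@[fun_prop]
lemma measurable_tailSqDist (θ₀ : ℕ → ℝ) (N : ℕ) : Measurable (tailSqDist θ₀ N) := by
  unfold tailSqDist
  exact Measurable.tsum fun i => by fun_prop

lemma l2norm_sub_eq_sqrt_toReal (θ₀ θ : ℕ → ℝ) :
    l2norm (fun i => θ i - θ₀ i) = √(tailSqDist θ₀ 0 θ).toReal := by
  rw [l2norm, tailSqDist, ENNReal.tsum_toReal_eq fun _ => ENNReal.ofReal_ne_top]
  congr 2 with i
  rw [ENNReal.toReal_ofReal (sq_nonneg _), add_zero]

lemma tailSqDist_zero_eq (θ₀ : ℕ → ℝ) (N : ℕ) (θ : ℕ → ℝ) :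
    tailSqDist θ₀ 0 θ =
      ∑ i ∈ Finset.range N, ENNReal.ofReal ((θ i - θ₀ i) ^ 2) + tailSqDist θ₀ N θ :=
  (ENNReal.summable.sum_add_tsum_nat_add' (k := N)
    (f := fun i => ENNReal.ofReal ((θ i - θ₀ i) ^ 2))).symm

lemma comap_tailSqDist_le (θ₀ : ℕ → ℝ) (N : ℕ) :
    MeasurableSpace.comap (tailSqDist θ₀ N) inferInstance ≤
      ⨆ i ∈ Ici N, MeasurableSpace.comap (fun θ : ℕ → ℝ => θ i) inferInstance := by
  rw [← measurable_iff_comap_le]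
  refine @Measurable.tsum _ _ _ (_) _ _ _ _ _ _ _ _ _ _ _ _ fun i => ?_
  have h : Measurable[⨆ i ∈ Ici N, MeasurableSpace.comap (fun θ : ℕ → ℝ => θ i) inferInstance]
      fun θ : ℕ → ℝ => θ (i + N) := by
    rw [measurable_iff_comap_le]
    exact le_iSup₂_of_le (i + N) (mem_Ici.2 (by omega)) le_rfl
  exact ENNReal.measurable_ofReal.comp ((h.sub_const _).pow_const 2)

variable [∀ i, IsProbabilityMeasure (ν i)]

lemma indep_head_tail (N : ℕ) :
    Indep (⨆ i ∈ Iio N, MeasurableSpace.comap (fun θ : ℕ → ℝ => θ i) inferInstance)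
      (⨆ i ∈ Ici N, MeasurableSpace.comap (fun θ : ℕ → ℝ => θ i) inferInstance)
      (Measure.infinitePi ν) := by
  have h : iIndepFun (fun (i : ℕ) (θ : ℕ → ℝ) => θ i) (Measure.infinitePi ν) :=
    iIndepFun_infinitePi (P := ν) (X := fun _ x => x) fun _ => measurable_id
  exact indep_iSup_of_disjoint (fun i => (measurable_pi_apply i).comap_le) h
    (disjoint_left.2 fun i hi hi' => not_lt.2 (mem_Ici.1 hi') (mem_Iio.1 hi))

lemma lintegral_tailSqDist (N : ℕ) :
    ∫⁻ θ, tailSqDist θ₀ N θ ∂Measure.infinitePi ν =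
      ∑' i, ∫⁻ x, ENNReal.ofReal ((x - θ₀ (i + N)) ^ 2) ∂ν (i + N) := by
  unfold tailSqDist
  rw [lintegral_tsum fun i => Measurable.aemeasurable (by fun_prop)]
  refine tsum_congr fun i => ?_
  rw [← Measure.infinitePi_map_eval ν (i + N), lintegral_map (by fun_prop) (by fun_prop)]

lemma ae_tailSqDist_ne_top (h : ∑' i, ∫⁻ x, ENNReal.ofReal ((x - θ₀ i) ^ 2) ∂ν i ≠ ⊤) :
    ∀ᵐ θ ∂Measure.infinitePi ν, tailSqDist θ₀ 0 θ ≠ ⊤ := by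
  refine (ae_lt_top (measurable_tailSqDist θ₀ 0) ?_).mono fun _ => LT.lt.ne
  simpa [lintegral_tailSqDist] using h

lemma measure_ofReal_sq_sub_eq_zero {μ : Measure ℝ} [NullSingletonClass μ] (a : ℝ) {c : ENNReal}
    (hc : c ≠ ⊤) (t : ENNReal) : μ {x | ENNReal.ofReal ((x - a) ^ 2) + t = c} = 0 := by
  refine ((Set.toFinite {a + √(c - t).toReal, a - √(c - t).toReal}).subset
    fun x hx => ?_).measure_zero μ
  have hx : ENNReal.ofReal ((x - a) ^ 2) + t = c := hx
  have ht : t ≠ ⊤ := fun h => hc (by simp [← hx, h])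
  have h : (c - t).toReal = (x - a) ^ 2 := by
    rw [← hx, ENNReal.add_sub_cancel_right ht, ENNReal.toReal_ofReal (sq_nonneg _)]
  rw [h, Real.sqrt_sq_eq_abs]
  rcases abs_choice (x - a) with h | h <;> simp [h]

lemma infinitePi_tailSqDist_eq_zero [NullSingletonClass (ν 0)] {c : ENNReal} (hc : c ≠ ⊤) :
    Measure.infinitePi ν {θ | tailSqDist θ₀ 0 θ = c} = 0 := by
  have hind : IndepFun (fun θ : ℕ → ℝ => θ 0) (tailSqDist θ₀ 1) (Measure.infinitePi ν) := by
    rw [IndepFun_iff_Indep]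
    exact indep_of_indep_of_le_left (indep_of_indep_of_le_right (indep_head_tail 1)
      (comap_tailSqDist_le θ₀ 1)) (le_iSup₂_of_le 0 (by simp) le_rfl)
  have hprod := hind.map_prod_eq_prod_map_map (measurable_pi_apply 0).aemeasurable
    (measurable_tailSqDist θ₀ 1).aemeasurable
  rw [Measure.infinitePi_map_eval] at hprod
  have hmeas : MeasurableSet
      {q : ℝ × ENNReal | ENNReal.ofReal ((q.1 - θ₀ 0) ^ 2) + q.2 = c} :=
    measurableSet_eq_fun (by fun_prop) measurable_const
  have hset : {θ | tailSqDist θ₀ 0 θ = c} = (fun θ : ℕ → ℝ => (θ 0, tailSqDist θ₀ 1 θ)) ⁻¹'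
      {q | ENNReal.ofReal ((q.1 - θ₀ 0) ^ 2) + q.2 = c} := by
    ext θ
    simp [tailSqDist_zero_eq θ₀ 1]
  rw [hset, ← Measure.map_apply (by fun_prop) hmeas, hprod, Measure.prod_apply_symm hmeas]
  simp only [preimage_ofPred_eq, measure_ofReal_sq_sub_eq_zero _ hc, lintegral_zero]

lemma exists_infinitePi_tailSqDist_lt_pos
    (h : ∑' i, ∫⁻ x, ENNReal.ofReal ((x - θ₀ i) ^ 2) ∂ν i ≠ ⊤) {δ : ENNReal} (hδ : 0 < δ) :
    ∃ N, 0 < Measure.infinitePi ν {θ | tailSqDist θ₀ N θ < δ} := by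
  obtain ⟨N, hN⟩ := ((ENNReal.tendsto_sum_nat_add _ h).eventually_lt_const hδ).exists
  refine ⟨N, pos_iff_ne_zero.2 fun h0 => ?_⟩
  have hae : ∀ᵐ θ ∂Measure.infinitePi ν, δ ≤ tailSqDist θ₀ N θ := by
    simpa [ae_iff] using h0
  have hle : ∫⁻ _, δ ∂Measure.infinitePi ν ≤ ∫⁻ θ, tailSqDist θ₀ N θ ∂Measure.infinitePi ν :=
    lintegral_mono_ae hae
  rw [lintegral_tailSqDist, lintegral_const, measure_univ, mul_one] at hle
  exact hN.not_ge hle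

lemma infinitePi_tailSqDist_lt_pos [∀ i, (ν i).IsOpenPosMeasure]
    (h : ∑' i, ∫⁻ x, ENNReal.ofReal ((x - θ₀ i) ^ 2) ∂ν i ≠ ⊤) {δ : ℝ} (hδ : 0 < δ) :
    0 < Measure.infinitePi ν {θ | tailSqDist θ₀ 0 θ < ENNReal.ofReal δ} := by
  obtain ⟨N, hN⟩ := exists_infinitePi_tailSqDist_lt_pos h (δ := ENNReal.ofReal (δ / 2))
    (by simpa using hδ)
  set r := √(δ / 2 / (N + 1)) with hr
  have hr0 : 0 < r := by positivity
  set A : Set (ℕ → ℝ) := Set.pi (Finset.range N) fun i => Metric.ball (θ₀ i) r with hA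
  set B : Set (ℕ → ℝ) := {θ | tailSqDist θ₀ N θ < ENNReal.ofReal (δ / 2)} with hB
  have hApos : 0 < Measure.infinitePi ν A := by
    rw [hA, Measure.infinitePi_pi ν fun i _ => Metric.isOpen_ball.measurableSet]
    exact pos_iff_ne_zero.2 (Finset.prod_ne_zero_iff.2 fun i _ =>
      (Metric.measure_ball_pos (ν i) (θ₀ i) hr0).ne')
  have hAB : Measure.infinitePi ν (A ∩ B) = Measure.infinitePi ν A * Measure.infinitePi ν B := by
    refine (Indep_iff _ _ _).1 (indep_head_tail N) A B ?_ ?_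
    · rw [hA, Set.pi_def]
      refine MeasurableSet.biInter (Finset.countable_toSet _) fun i hi => ?_
      have hle : MeasurableSpace.comap (fun θ : ℕ → ℝ => θ i) inferInstance ≤
          ⨆ i ∈ Iio N, MeasurableSpace.comap (fun θ : ℕ → ℝ => θ i) inferInstance :=
        le_iSup₂_of_le i (by simpa using hi) le_rfl
      exact hle _ ⟨_, Metric.isOpen_ball.measurableSet, rfl⟩
    · exact comap_tailSqDist_le θ₀ N _ ⟨Iio _, measurableSet_Iio, rfl⟩
  refine lt_of_lt_of_le (ENNReal.mul_pos hApos.ne' hN.ne') (hAB ▸ measure_mono ?_)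
  rintro θ ⟨hθA, hθB⟩
  have hhead : ∑ i ∈ Finset.range N, ENNReal.ofReal ((θ i - θ₀ i) ^ 2) ≤
      ENNReal.ofReal (δ / 2) := by
    rw [← ENNReal.ofReal_sum_of_nonneg fun _ _ => sq_nonneg _]
    refine ENNReal.ofReal_le_ofReal ?_
    calc ∑ i ∈ Finset.range N, (θ i - θ₀ i) ^ 2
        ≤ ∑ i ∈ Finset.range N, δ / 2 / (N + 1) := by
          refine Finset.sum_le_sum fun i hi => ?_
          have hi' : |θ i - θ₀ i| < r := by simpa [Real.dist_eq] using hθA i hi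
          rw [← sq_abs, ← Real.sq_sqrt (show 0 ≤ δ / 2 / (N + 1) by positivity)]
          gcongr
      _ ≤ δ / 2 := by
          rw [Finset.sum_const, Finset.card_range, nsmul_eq_mul, mul_div_assoc', div_le_iff₀
            (by positivity)]
          nlinarith
  change tailSqDist θ₀ 0 θ < ENNReal.ofReal δ
  rw [tailSqDist_zero_eq θ₀ N, ← add_halves δ, ENNReal.ofReal_add (by positivity) (by positivity)]
  exact ENNReal.add_lt_add_of_le_of_lt (ne_top_of_le_ne_top ENNReal.ofReal_ne_top hhead) hhead hθB

end ProductMeasure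

lemma continuous_cdf (μ : Measure ℝ) [IsProbabilityMeasure μ] [NullSingletonClass μ] :
    Continuous (cdf μ) := by
  refine continuous_iff_continuousAt.2 fun x => ?_
  rw [(monotone_cdf μ).continuousAt_iff_leftLim_eq_rightLim, StieltjesFunction.rightLim_eq]
  refine le_antisymm ((monotone_cdf μ).leftLim_le le_rfl) ?_
  have h := (cdf μ).measure_singleton x
  rw [measure_cdf, measure_singleton] at h
  linarith [ENNReal.ofReal_eq_zero.1 h.symm]

/-- **Lemma B.1**: existence and uniqueness of the solution `ε_n` of
`Π(θ : ‖θ−θ₀‖₂ ≤ Kε_n | α,τ) = e^{−nε_n²}`, and the sequence `(ε_n)_{n≥1}` is strictly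
decreasing to zero. -/
theorem eps_exists_unique
    (p : ℝ) (hp : p ∈ Set.Icc (1 : ℝ) 2)
    (α τ : ℝ) (hα : 0 < α) (hτ : 0 < τ)
    -- the α-regular τ-scaled p-exponential prior
    (Prior : Measure (ℕ → ℝ)) (hPrior : IsPexpPrior p α τ Prior)
    (θ₀ : ℕ → ℝ) (hθ₀ : Summable fun i => θ₀ i ^ 2)
    (K : ℝ) (hK : 0 < K) :
    ∃ e : ℕ → ℝ,
      (∀ n : ℕ, 1 ≤ n →
        0 < e n ∧
        Prior {θ | l2norm (fun i => θ i - θ₀ i) ≤ K * e n} =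
          ENNReal.ofReal (Real.exp (-(n : ℝ) * (e n) ^ 2)) ∧
        -- uniqueness
        (∀ x : ℝ, 0 < x →
          Prior {θ | l2norm (fun i => θ i - θ₀ i) ≤ K * x} =
            ENNReal.ofReal (Real.exp (-(n : ℝ) * x ^ 2)) → x = e n)) ∧
      -- strictly decreasing on n ≥ 1
      (∀ m n : ℕ, 1 ≤ m → m < n → e n < e m) ∧
      -- converging to zero
      Filter.Tendsto e Filter.atTop (nhds 0) := by
  have hp0 : 0 < p := one_pos.trans_le hp.1
  have hprob := hPrior.isProbabilityMeasure_coordLaw hp0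
  have hnull := nullSingletonClass_coordLaw p α hτ
  have hopen := isOpenPosMeasure_coordLaw hp0 α hτ
  have hsum := tsum_lintegral_sq_sub_coordLaw_ne_top hp0 hα τ hθ₀
  obtain rfl := hPrior.eq_infinitePi
  set P := Measure.infinitePi (coordLaw p α τ)
  set R : (ℕ → ℝ) → ℝ := fun θ => l2norm fun i => θ i - θ₀ i with hR
  have hRm : Measurable R := by
    simp only [hR, l2norm_sub_eq_sqrt_toReal]
    fun_prop
  have hatom (r : ℝ) : P {θ | R θ = r} = 0 := by
    refine measure_mono_null (fun θ hθ => ?_) (measure_union_null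
      (infinitePi_tailSqDist_eq_zero (θ₀ := θ₀) (ν := coordLaw p α τ)
        (ENNReal.ofReal_ne_top (r := r ^ 2))) (ae_iff.1 (ae_tailSqDist_ne_top hsum)))
    by_cases h : tailSqDist θ₀ 0 θ = ⊤
    · exact Or.inr (not_not.2 h)
    · refine Or.inl ?_
      have hθ : l2norm (fun i => θ i - θ₀ i) = r := hθ
      rw [mem_ofPred_eq, ← hθ, l2norm_sub_eq_sqrt_toReal, Real.sq_sqrt ENNReal.toReal_nonneg,
        ENNReal.ofReal_toReal h]
  have : IsProbabilityMeasure (P.map R) := Measure.isProbabilityMeasure_map hRm.aemeasurable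
  have : NullSingletonClass (P.map R) :=
    ⟨fun r => by rw [Measure.map_apply hRm (measurableSet_singleton r)]; exact hatom r⟩
  have hF (x : ℝ) : P {θ | R θ ≤ K * x} = ENNReal.ofReal (cdf (P.map R) (K * x)) := by
    rw [ofReal_cdf, Measure.map_apply hRm measurableSet_Iic]
    rfl
  have hzero : cdf (P.map R) (K * 0) = 0 := by
    have h : P {θ | R θ ≤ K * 0} = 0 :=
      measure_mono_null (fun θ (hθ : R θ ≤ K * 0) =>
        le_antisymm (hθ.trans_eq (mul_zero K)) (Real.sqrt_nonneg _)) (hatom 0)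
    rw [hF, ENNReal.ofReal_eq_zero] at h
    exact le_antisymm h (cdf_nonneg _ _)
  have hpos (x : ℝ) (hx : 0 < x) : 0 < cdf (P.map R) (K * x) := by
    rw [← ENNReal.ofReal_pos, ← hF]
    refine (infinitePi_tailSqDist_lt_pos hsum (δ := (K * x) ^ 2) (by positivity)).trans_le
      (measure_mono fun θ hθ => ?_)
    change l2norm (fun i => θ i - θ₀ i) ≤ K * x
    rw [l2norm_sub_eq_sqrt_toReal]
    refine Real.sqrt_le_iff.2 ⟨by positivity, ?_⟩
    exact ENNReal.toReal_le_of_le_ofReal (by positivity) (le_of_lt hθ)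
  obtain ⟨e, he, hanti, hlim⟩ := exists_unique_eq_exp_neg_mul_sq
    (F := fun x => cdf (P.map R) (K * x))
    (fun x y hxy => monotone_cdf _ (by gcongr))
    ((continuous_cdf (P.map R)).comp (continuous_const_mul K)) hzero
    ((tendsto_cdf_atTop (P.map R)).comp (tendsto_id.const_mul_atTop hK)) hpos
  refine ⟨e, fun n hn => ?_, hanti, hlim⟩
  obtain ⟨h0, h1, h2⟩ := he n hn
  refine ⟨h0, by rw [hF, h1], fun x hx hxe => h2 x hx ?_⟩
  rwa [hF, ENNReal.ofReal_eq_ofReal_iff (cdf_nonneg _ _) (Real.exp_nonneg _)] at hxe
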